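/- arXiv:cs/0607021 — 4 statements merged into one kernel-verified Lean document; each statement's English description precedes it below -/
import Mathlib

section
/- Let Y be a finite set and let P be a probability distribution on {0,1}×Y with P(x,y) > 0 for all x ∈ {0,1}, y ∈ Y. Then the initial message distribution ⟨P⁽⁰⁾⟩ induced by P is symmetric; that is, for every r ∈ ℝ, ⟨P⁽⁰⁾⟩({−r}) = e^{−r} · ⟨P⁽⁰⁾⟩({r}). -/
open scoped Classical

/-- The initial message distribution ⟨P⁽⁰⁾⟩ induced by a source distribution `P` on
`{0,1} × Y` (with `P false y = P(0,y)` and `P true y = P(1,y)`): it assigns to `r ∈ ℝ` the mass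
`Σ_{y : m(y) = r} P(0,y) + Σ_{y : m(y) = -r} P(1,y)`, where `m(y) = ln (P(0,y)/P(1,y))`. -/
noncomputable def initMsg {Y : Type*} [Fintype Y] (P : Bool → Y → ℝ) (r : ℝ) : ℝ :=
  (∑ y : Y, if Real.log (P false y / P true y) = r then P false y else 0) +
  (∑ y : Y, if Real.log (P false y / P true y) = -r then P true y else 0)

/-- For a probability distribution `P` on `{0,1} × Y` with all entries positive,
the induced initial message distribution is symmetric:
`⟨P⁽⁰⁾⟩({-r}) = e^{-r} ⟨P⁽⁰⁾⟩({r})` for all `r ∈ ℝ`. -/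
theorem initMsg_symmetric {Y : Type*} [Fintype Y] (P : Bool → Y → ℝ)
    (hpos : ∀ (x : Bool) (y : Y), 0 < P x y)
    (hsum : ∑ x : Bool, ∑ y : Y, P x y = 1) :
    ∀ r : ℝ, initMsg P (-r) = Real.exp (-r) * initMsg P r := by
  intro r
  have hlog (y : Y) {s : ℝ} (h : Real.log (P false y / P true y) = s) :
      P false y = Real.exp s * P true y := by
    rw [← h, Real.exp_log (div_pos (hpos _ _) (hpos _ _)), div_mul_cancel₀ _ (hpos _ _).ne']
  simp only [initMsg, neg_neg, mul_add, Finset.mul_sum, mul_ite, mul_zero]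
  rw [add_comm]
  congr 1 <;> refine Finset.sum_congr rfl fun y _ => ?_
  · split_ifs with h
    · rw [hlog y h, ← mul_assoc, ← Real.exp_add, neg_add_cancel, Real.exp_zero, one_mul]
    · rfl
  · split_ifs with h
    · exact hlog y h
    · rfl
end

section
/- Let Y be a finite set and let P be a probability distribution on {0,1}×Y with P(x,y) > 0 for all x, y. Then the uniform-input mutual information C of the channel Ch(P) satisfies H(X|Y) + C = 1, where H(X|Y) is the conditional entropy of P. -/
open scoped Classical

/-- The conditional entropy `H(X|Y)` of a source distribution `P` on `{0,1} × Y`. -/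
noncomputable def condEnt {Y : Type*} [Fintype Y] (P : Bool → Y → ℝ) : ℝ :=
  -∑ x : Bool, ∑ y : Y, P x y * Real.logb 2 (P x y / (P false y + P true y))

/-- The channel `Ch(P)` associated with a source distribution `P` on `{0,1} × Y`. -/
def Ch {Y : Type*} (P : Bool → Y → ℝ) (x : Bool) (z : Y × Bool) : ℝ :=
  P (xor x z.2) z.1

/-- The uniform-input mutual information of a binary-input channel `p` with finite
output alphabet `Z`: `C = Σ_x Σ_z (1/2) p(z|x) log₂( p(z|x) / ((p(z|0)+p(z|1))/2) )`. -/
noncomputable def uniformMI {Z : Type*} [Fintype Z] (p : Bool → Z → ℝ) : ℝ :=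
  ∑ x : Bool, ∑ z : Z, (1 / 2) * p x z * Real.logb 2 (p x z / ((p false z + p true z) / 2))

theorem logb_two_div_half {a s : ℝ} (ha : a ≠ 0) (hs : s ≠ 0) :
    Real.logb 2 (a / (s / 2)) = 1 + Real.logb 2 (a / s) := by
  rw [show a / (s / 2) = 2 * (a / s) by field_simp,
    Real.logb_mul two_ne_zero (div_ne_zero ha hs), Real.logb_self_eq_one one_lt_two]

/-- For a probability distribution `P` on `{0,1} × Y` with all entries positive,
the uniform-input mutual information `C` of `Ch(P)` satisfies `H(X|Y) + C = 1`. -/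
theorem condEnt_add_capacity {Y : Type*} [Fintype Y] (P : Bool → Y → ℝ)
    (hpos : ∀ (x : Bool) (y : Y), 0 < P x y)
    (hsum : ∑ x : Bool, ∑ y : Y, P x y = 1) :
    condEnt P + uniformMI (Ch P) = 1 := by
  have hs (y : Y) : P false y + P true y ≠ 0 := (add_pos (hpos _ y) (hpos _ y)).ne'
  have key (x : Bool) (y : Y) :
      Real.logb 2 (P x y / ((P false y + P true y) / 2)) =
        1 + Real.logb 2 (P x y / (P false y + P true y)) :=
    logb_two_div_half (hpos x y).ne' (hs y)
  have hcomm (y : Y) : P true y + P false y = P false y + P true y := add_comm _ _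
  rw [← hsum]
  simp only [condEnt, uniformMI, Ch, Fintype.sum_prod_type, Fintype.sum_bool, Bool.xor_false,
    Bool.xor_true, Bool.not_true, Bool.not_false, hcomm, key, ← Finset.sum_add_distrib,
    ← Finset.sum_neg_distrib]
  refine Finset.sum_congr rfl fun y _ => ?_
  ring
end

section
/- Let p be a binary-input output-symmetric channel with finite output alphabet 𝒴 and p(y|x) > 0 for all y ∈ 𝒴, x ∈ {0,1}. Then its uniform-input mutual information C satisfies C = 1 − Σ_{y∈𝒴} p(y|0) · log₂( 1 + e^{−m(y)} ), where m(y) = ln( p(y|0)/p(y|1) ); i.e., C = 1 minus the expectation of log₂(1 + e^{−M}) where M is distributed according to the channel's log-likelihood-ratio distribution under input 0. -/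
open scoped Classical

/-- An output-symmetric channel with positive transition probabilities admits an involution of
its output alphabet that exchanges the two transition laws. -/
theorem exists_involutive_of_outputSymmetric {Z : Type*} [Fintype Z] (p : Bool → Z → ℝ)
    (hpos : ∀ (x : Bool) (z : Z), 0 < p x z)
    (hBIOS : ∃ φ : Z → ℝ, Function.Injective φ ∧
      ∀ r : ℝ,
        (∑ z : Z, if φ z = r then p false z else 0) =
        (∑ z : Z, if φ z = -r then p true z else 0)) :
    ∃ σ : Z → Z, Function.Involutive σ ∧
      (∀ z, p false (σ z) = p true z) ∧ ∀ z, p true (σ z) = p false z := by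
  obtain ⟨φ, hφ, h⟩ := hBIOS
  have hsingle : ∀ x w, (∑ z : Z, if φ z = φ w then p x z else 0) = p x w := by
    intro x w
    simp [hφ.eq_iff]
  have hex : ∀ z, ∃ w, φ w = -φ z := by
    intro z
    by_contra! hne
    have hz := h (φ z)
    rw [hsingle] at hz
    simp only [hne, if_false, Finset.sum_const_zero] at hz
    exact (hpos false z).ne' hz
  choose σ hσ using hex
  refine ⟨σ, fun z => hφ (by rw [hσ, hσ, neg_neg]), fun z => ?_, fun z => ?_⟩
  · have hz := h (φ (σ z))
    rwa [hsingle, hσ, neg_neg, hsingle] at hz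
  · have hz := h (φ z)
    rw [← hσ, hsingle, hsingle] at hz
    exact hz.symm

/-- The information density of an input in terms of the log-likelihood ratio. -/
theorem logb_div_average_eq {a b : ℝ} (ha : 0 < a) (hb : 0 < b) :
    Real.logb 2 (a / ((a + b) / 2)) = 1 - Real.logb 2 (1 + Real.exp (-(Real.log (a / b)))) := by
  rw [Real.exp_neg, Real.exp_log (div_pos ha hb)]
  have h : a / ((a + b) / 2) = 2 / (1 + (a / b)⁻¹) := by
    field_simp
  rw [h, Real.logb_div two_ne_zero (by positivity), Real.logb_self_eq_one one_lt_two]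

/-- For a binary-input output-symmetric channel `p` with finite output alphabet
and positive transition probabilities, the uniform-input mutual information satisfies
`C = 1 - Σ_z p(z|0) log₂(1 + e^{-m(z)})` where `m(z) = ln(p(z|0)/p(z|1))`. -/
theorem capacity_BIOS {Z : Type*} [Fintype Z] (p : Bool → Z → ℝ)
    (hpos : ∀ (x : Bool) (z : Z), 0 < p x z)
    (hsum : ∀ x : Bool, ∑ z : Z, p x z = 1)
    (hBIOS : ∃ φ : Z → ℝ, Function.Injective φ ∧
      ∀ r : ℝ,
        (∑ z : Z, if φ z = r then p false z else 0) =
        (∑ z : Z, if φ z = -r then p true z else 0)) :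
    uniformMI p =
      1 - ∑ z : Z, p false z * Real.logb 2 (1 + Real.exp (-(Real.log (p false z / p true z)))) := by
  obtain ⟨σ, hσ, hfalse, htrue⟩ := exists_involutive_of_outputSymmetric p hpos hBIOS
  have hswap :
      (∑ z, (1 / 2) * p true z * Real.logb 2 (p true z / ((p false z + p true z) / 2))) =
      ∑ z, (1 / 2) * p false z * Real.logb 2 (p false z / ((p false z + p true z) / 2)) := by
    refine Fintype.sum_bijective σ hσ.bijective _ _ fun z => ?_
    rw [hfalse, htrue, add_comm (p true z)]
  rw [uniformMI, Fintype.sum_bool, hswap, ← Finset.sum_add_distrib, eq_sub_iff_add_eq,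
    ← Finset.sum_add_distrib, ← hsum false]
  refine Finset.sum_congr rfl fun z _ => ?_
  rw [hsum, logb_div_average_eq (hpos false z) (hpos true z)]
  ring
end

section
/- Let n ≥ 1 and let a₀, …, a_{n−1} ∈ (0,1] with Σᵢ aᵢ = 1; set λᵢ = ln( aᵢ / a_{n−1−i} ). Let α₀, …, α_{n−1} ∈ [0,1] satisfy αᵢ + α_{n−1−i} = 1 for all i. Define a probability distribution P on {0,1}×{0,…,n−1} by P(0,i) = αᵢ aᵢ and P(1,i) = αᵢ a_{n−1−i}. Then P is a probability distribution, and the initial message distribution it induces assigns to each r ∈ ℝ the mass Σ_{i : λᵢ = r} aᵢ (where the masses of P are aggregated only over indices i with P(0,i)+P(1,i) > 0). In particular, all distributions P of this form, for all admissible choices of (αᵢ), induce the same initial message distribution. -/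
open scoped Classical

/-- The initial message distribution induced by a source distribution `P` on `{0,1} × Y`,
where the masses are aggregated only over symbols `y` with `P(0,y) + P(1,y) > 0`:
it assigns to `r ∈ ℝ` the mass
`Σ_{y : P(0,y)+P(1,y)>0, m(y)=r} P(0,y) + Σ_{y : P(0,y)+P(1,y)>0, m(y)=-r} P(1,y)`,
where `m(y) = ln (P(0,y)/P(1,y))`. -/
noncomputable def initMsg' {Y : Type*} [Fintype Y] (P : Bool → Y → ℝ) (r : ℝ) : ℝ :=
  (∑ y : Y, if 0 < P false y + P true y ∧ Real.log (P false y / P true y) = r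
    then P false y else 0) +
  (∑ y : Y, if 0 < P false y + P true y ∧ Real.log (P false y / P true y) = -r
    then P true y else 0)

/-- Scaling both masses of a symbol by a common factor `c ≥ 0` keeps its log-likelihood ratio, and
the restriction to symbols of positive total mass is immaterial since the excluded mass is zero. -/
lemma ite_scaled_mass {c p q : ℝ} (hc : 0 ≤ c) (hp : 0 < p) (hq : 0 < q) (r m : ℝ) :
    (if 0 < c * p + c * q ∧ Real.log (c * p / (c * q)) = r then c * m else 0) =
      c * if Real.log (p / q) = r then m else 0 := by
  rcases hc.eq_or_lt with rfl | hc
  · simp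
  · have hpos : 0 < c * p + c * q := by positivity
    simp only [hpos, true_and, mul_div_mul_left p q hc.ne', mul_ite, mul_zero]

/-- Let `a₀, …, a_{n-1} ∈ (0,1]` sum to 1 and `λᵢ = ln(aᵢ / a_{n-1-i})`.
Let `αᵢ ∈ [0,1]` with `αᵢ + α_{n-1-i} = 1`, and define `P(0,i) = αᵢ aᵢ`,
`P(1,i) = αᵢ a_{n-1-i}`. Then `P` is a probability distribution and its initial message
distribution assigns to each `r` the mass `Σ_{i : λᵢ = r} aᵢ`; in particular it does not
depend on the choice of `(αᵢ)`. -/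
theorem equiv_class_initMsg (n : ℕ) (hn : 1 ≤ n)
    (a : Fin n → ℝ) (ha : ∀ i, a i ∈ Set.Ioc (0 : ℝ) 1) (hsuma : ∑ i, a i = 1)
    (α : Fin n → ℝ) (hα : ∀ i, α i ∈ Set.Icc (0 : ℝ) 1)
    (hαrev : ∀ i, α i + α i.rev = 1) :
    ((∀ (x : Bool) (i : Fin n), 0 ≤ (fun (x : Bool) (i : Fin n) =>
        α i * (if x then a i.rev else a i)) x i) ∧
      ∑ x : Bool, ∑ i : Fin n,
        (fun (x : Bool) (i : Fin n) => α i * (if x then a i.rev else a i)) x i = 1) ∧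
    ∀ r : ℝ,
      initMsg' (fun (x : Bool) (i : Fin n) => α i * (if x then a i.rev else a i)) r =
        ∑ i : Fin n, if Real.log (a i / a i.rev) = r then a i else 0 := by
  have hrev_sum (f : Fin n → ℝ) : ∑ i, f i = ∑ i : Fin n, f i.rev :=
    (Equiv.sum_comp Fin.revPerm f).symm
  refine ⟨⟨fun x i => ?_, ?_⟩, fun r => ?_⟩
  · refine mul_nonneg (hα i).1 ?_
    split_ifs
    exacts [(ha _).1.le, (ha _).1.le]
  · simp only [Fintype.sum_bool, if_true, Bool.false_eq_true, if_false]
    rw [hrev_sum fun i => α i * a i.rev, ← Finset.sum_add_distrib, ← hsuma]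
    refine Finset.sum_congr rfl fun i _ => ?_
    rw [Fin.rev_rev]
    linear_combination a i * hαrev i
  · simp only [initMsg', if_true, Bool.false_eq_true, if_false,
      ite_scaled_mass (hα _).1 (ha _).1 (ha _).1]
    rw [hrev_sum fun i => α i * if Real.log (a i / a i.rev) = -r then a i.rev else 0,
      ← Finset.sum_add_distrib]
    refine Finset.sum_congr rfl fun i _ => ?_
    have hlog : Real.log (a i.rev / a i) = -Real.log (a i / a i.rev) := by
      rw [← Real.log_inv, inv_div]
    simp only [Fin.rev_rev, hlog, neg_inj]
    rw [← add_mul, hαrev, one_mul]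
end
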